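/- Let n ≥ 2, m ≥ 1, 0 < α < mn, 1 < s ≤ ∞, and let Ω⃗ = (Ω_1,…,Ω_m) ∈ L^s(S^{n−1}). Let s' ≤ p_1,…,p_m < ∞, 1/p = 1/p_1 + ⋯ + 1/p_m with p < n/α, define q by 1/q = 1/p − α/n, and set κ = p/q = 1 − αp/n. Then there exists a constant C > 0, independent of f⃗, such that for all measurable f_i with ‖f_i‖_{L^{p_i,κ}} < ∞ (i = 1,…,m), ‖M_{Ω,α;m}(f⃗)‖_{L^∞(ℝⁿ)} ≤ C ∏_{i=1}^m ‖f_i‖_{L^{p_i,κ}}. -/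

import Mathlib

open MeasureTheory Metric ENNReal

noncomputable section

/-- Euclidean space `ℝⁿ`. -/
abbrev Euc (n : ℕ) := EuclideanSpace ℝ (Fin n)

/-- `Ω` is homogeneous of degree zero. -/
def HomogZero {n : ℕ} (Ω : Euc n → ℝ) : Prop :=
  ∀ ⦃l : ℝ⦄, 0 < l → ∀ x, Ω (l • x) = Ω x

/-- The `L^s` norm of `Ω` on the unit sphere `S^{n-1}`, where the surface measure
`volume.toSphere` is normalized so that the polar coordinate formula
`∫_{ℝⁿ} g(y) dy = ∫_0^∞ ∫_{S^{n-1}} g(ρθ) ρ^{n-1} dσ(θ) dρ` holds. -/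
noncomputable def sphereLpNorm (n : ℕ) (s : ℝ≥0∞) (Ω : Euc n → ℝ) : ℝ≥0∞ :=
  eLpNorm (fun θ : sphere (0 : Euc n) 1 => Ω θ.1) s ((volume : Measure (Euc n)).toSphere)

/-- `Ω ∈ L^s(S^{n-1})`: measurable, homogeneous of degree zero, finite sphere `L^s` norm. -/
def MemSphereLp (n : ℕ) (s : ℝ≥0∞) (Ω : Euc n → ℝ) : Prop :=
  Measurable Ω ∧ HomogZero Ω ∧ sphereLpNorm n s Ω < ⊤

/-- The conjugate exponent `s' = s/(s-1)` (with `s' = 1` for `s = ∞`). -/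
noncomputable def conjExp (s : ℝ≥0∞) : ℝ := if s = ⊤ then 1 else s.toReal / (s.toReal - 1)

/-- The multilinear fractional integral operator with homogeneous kernels,
`T_{Ω,α;m}(f⃗)(x) = ∫_{(ℝⁿ)^m} ∏ᵢ Ωᵢ(x-yᵢ) fᵢ(yᵢ) / ‖(x-y₁,…,x-y_m)‖^{mn-α} dy⃗`. -/
noncomputable def multiT {n : ℕ} (m : ℕ) (α : ℝ) (Ω f : Fin m → Euc n → ℝ) (x : Euc n) : ℝ :=
  ∫ y : Fin m → Euc n,
    (∏ i, Ω i (x - y i) * f i (y i)) /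
      (Real.sqrt (∑ j, ‖x - y j‖ ^ 2)) ^ ((m * n : ℝ) - α)

/-- The multilinear maximal operator `𝓜(f⃗)(x)`, with values in `[0,∞]`. -/
noncomputable def multiM {n : ℕ} (m : ℕ) (f : Fin m → Euc n → ℝ) (x : Euc n) : ℝ≥0∞ :=
  ⨆ r : Set.Ioi (0 : ℝ),
    ∏ i, (volume (ball x (r : ℝ)))⁻¹ * ∫⁻ y in ball x (r : ℝ), ENNReal.ofReal |f i y|

/-- `𝓜_t(f⃗)(x) = 𝓜(|f₁|^t,…,|f_m|^t)(x)^{1/t}`, with values in `[0,∞]`. -/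
noncomputable def multiMt {n : ℕ} (m : ℕ) (t : ℝ) (f : Fin m → Euc n → ℝ) (x : Euc n) : ℝ≥0∞ :=
  (multiM m (fun i y => |f i y| ^ t) x) ^ (1 / t)

/-- The multilinear fractional maximal operator with homogeneous kernels,
`M_{Ω,α;m}(f⃗)(x) = sup_{r>0} ∏ᵢ m(B(x,r))^{α/(mn)-1} ∫_{|x-yᵢ|<r} |Ωᵢ(x-yᵢ) fᵢ(yᵢ)| dyᵢ`,
with values in `[0,∞]`. -/
noncomputable def multiMF {n : ℕ} (m : ℕ) (α : ℝ) (Ω f : Fin m → Euc n → ℝ) (x : Euc n) :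
    ℝ≥0∞ :=
  ⨆ r : Set.Ioi (0 : ℝ),
    ∏ i, (volume (ball x (r : ℝ))) ^ (α / (m * n : ℝ) - 1) *
      ∫⁻ y in ball x (r : ℝ), ENNReal.ofReal |Ω i (x - y) * f i y|

/-- Morrey norm of a `[0,∞]`-valued function:
`sup_B (m(B)^{-κ} ∫_B F^p)^{1/p}`, the supremum over all balls `B ⊆ ℝⁿ`. -/
noncomputable def morreyNormE {n : ℕ} (p κ : ℝ) (F : Euc n → ℝ≥0∞) : ℝ≥0∞ :=
  ⨆ (z : Euc n) (r : Set.Ioi (0 : ℝ)),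
    (volume (ball z (r : ℝ)) ^ (-κ) * ∫⁻ y in ball z (r : ℝ), F y ^ p) ^ (1 / p)

/-- Morrey norm `‖f‖_{L^{p,κ}}`. -/
noncomputable def morreyNorm {n : ℕ} (p κ : ℝ) (f : Euc n → ℝ) : ℝ≥0∞ :=
  morreyNormE p κ (fun x => ENNReal.ofReal |f x|)

/-- Weak Morrey norm of a `[0,∞]`-valued function:
`sup_B sup_{l>0} m(B)^{-κ/p} · l · m({y ∈ B : F y > l})^{1/p}`. -/
noncomputable def weakMorreyNormE {n : ℕ} (p κ : ℝ) (F : Euc n → ℝ≥0∞) : ℝ≥0∞ :=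
  ⨆ (z : Euc n) (r : Set.Ioi (0 : ℝ)) (l : Set.Ioi (0 : ℝ)),
    volume (ball z (r : ℝ)) ^ (-(κ / p)) * ENNReal.ofReal (l : ℝ) *
      (volume {y | y ∈ ball z (r : ℝ) ∧ ENNReal.ofReal (l : ℝ) < F y}) ^ (1 / p)

/-- Weak Morrey norm `‖f‖_{WL^{p,κ}}`. -/
noncomputable def weakMorreyNorm {n : ℕ} (p κ : ℝ) (f : Euc n → ℝ) : ℝ≥0∞ :=
  weakMorreyNormE p κ (fun x => ENNReal.ofReal |f x|)

/-- Luxemburg norm `‖f‖_{L^p log L(B)}`. -/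
noncomputable def luxNorm {n : ℕ} (p : ℝ) (B : Set (Euc n)) (f : Euc n → ℝ) : ℝ :=
  sInf {l : ℝ | 0 < l ∧
    ∫⁻ x in B, ENNReal.ofReal ((|f x| / l) ^ p * (1 + max (Real.log (|f x| / l)) 0)) ≤ 1}

/-- `‖f‖_{(L log L)^{p,κ}} = sup_B m(B)^{-κ/p} ‖f‖_{L^p log L(B)}`. -/
noncomputable def logMorreyNorm {n : ℕ} (p κ : ℝ) (f : Euc n → ℝ) : ℝ≥0∞ :=
  ⨆ (z : Euc n) (r : Set.Ioi (0 : ℝ)),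
    volume (ball z (r : ℝ)) ^ (-(κ / p)) *
      ENNReal.ofReal (luxNorm p (ball z (r : ℝ)) f)

/-- Weak `L^p` norm `‖f‖_{L^{p,∞}} = sup_{l>0} l · m({|f| > l})^{1/p}`. -/
noncomputable def weakLpNorm {n : ℕ} (p : ℝ) (f : Euc n → ℝ) : ℝ≥0∞ :=
  ⨆ l : Set.Ioi (0 : ℝ),
    ENNReal.ofReal (l : ℝ) * (volume {x | (l : ℝ) < |f x|}) ^ (1 / p)

theorem prod_rpow_eq_rpow_sum {ι : Type*} {a : ℝ≥0∞} (ha : a ≠ 0) (ha' : a ≠ ⊤) (e : ι → ℝ)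
    (t : Finset ι) : ∏ i ∈ t, a ^ e i = a ^ ∑ i ∈ t, e i := by
  classical
  induction t using Finset.induction_on with
  | empty => simp
  | insert i t hi ih => rw [Finset.prod_insert hi, Finset.sum_insert hi, ih,
      ENNReal.rpow_add _ _ ha ha']

/-- Polar coordinates: on a ball centered at the origin, the `L^s` norm of a function homogeneous of
degree zero is a multiple of its `L^s` norm on the sphere. -/
theorem eLpNorm_ball_eq_sphereLpNorm {n : ℕ} (hn : 1 ≤ n) {s : ℝ≥0∞} {Ω : Euc n → ℝ}
    (hΩ : Measurable Ω) (hΩ₀ : HomogZero Ω) {r : ℝ} (hr : 0 < r) :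
    eLpNorm Ω s (volume.restrict (ball (0 : Euc n) r)) =
      (volume (ball (0 : Euc n) r) / (volume : Measure (Euc n)).toSphere Set.univ) ^
        (1 / s).toReal * sphereLpNorm n s Ω := by
  have : Nonempty (Fin n) := ⟨⟨0, hn⟩⟩
  set σ := (volume : Measure (Euc n)).toSphere with hσ
  set ν := Measure.volumeIoiPow (Module.finrank ℝ (Euc n) - 1) with hν
  set g : sphere (0 : Euc n) 1 × Set.Ioi (0 : ℝ) → Euc n :=
    fun z => ((homeomorphUnitSphereProd (Euc n)).symm z : Euc n) with hg
  have hgz : ∀ z, g z = (z.2 : ℝ) • (z.1 : Euc n) := fun z => by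
    simp [hg]
  have hmp : MeasurePreserving g (σ.prod ν) (volume : Measure (Euc n)) := by
    have h1 : MeasurePreserving (homeomorphUnitSphereProd (Euc n)).toMeasurableEquiv.symm
        (σ.prod ν) ((volume : Measure (Euc n)).comap (Subtype.val : ({0}ᶜ : Set (Euc n)) → _)) :=
      MeasurePreserving.symm (homeomorphUnitSphereProd (Euc n)).toMeasurableEquiv
        (Measure.measurePreserving_homeomorphUnitSphereProd (volume : Measure (Euc n)))
    have h2 := (measurePreserving_subtype_coe (μa := (volume : Measure (Euc n)))
      (measurableSet_singleton (0 : Euc n)).compl).comp h1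
    rwa [restrict_compl_singleton] at h2
  have hpre : g ⁻¹' ball 0 r = Set.univ ×ˢ Set.Iio ⟨r, hr⟩ := by
    ext z
    have hz : ‖(z.1 : Euc n)‖ = 1 := by simp
    have hz2 : 0 < (z.2 : ℝ) := z.2.2
    simp [hgz, norm_smul, hz, abs_of_pos hz2, ← Subtype.coe_lt_coe]
  have hmp' : MeasurePreserving g (σ.prod (ν.restrict (Set.Iio ⟨r, hr⟩)))
      (volume.restrict (ball (0 : Euc n) r)) := by
    have := hmp.restrict_preimage (s := ball (0 : Euc n) r) measurableSet_ball
    rwa [hpre, ← Measure.prod_restrict, Measure.restrict_univ] at this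
  have hσ0 : σ Set.univ ≠ 0 :=
    Measure.measure_univ_ne_zero.2 (Measure.toSphere_ne_zero volume)
  have hσt : σ Set.univ ≠ ⊤ := measure_ne_top _ _
  have hvol : volume (ball (0 : Euc n) r) = σ Set.univ * ν (Set.Iio ⟨r, hr⟩) := by
    rw [← hmp.measure_preimage measurableSet_ball.nullMeasurableSet, hpre, Measure.prod_prod]
  have hν' : ν (Set.Iio ⟨r, hr⟩) = volume (ball (0 : Euc n) r) / σ Set.univ := by
    rw [hvol, mul_comm, ENNReal.mul_div_cancel_right hσ0 hσt]
  have hν0 : ν (Set.Iio ⟨r, hr⟩) ≠ 0 := by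
    intro h
    rw [h, mul_zero] at hvol
    exact (measure_ball_pos volume (0 : Euc n) hr).ne' hvol
  have hcomp : Ω ∘ g = (fun θ : sphere (0 : Euc n) 1 => Ω θ.1) ∘ Prod.fst := by
    funext z
    simpa [hgz] using hΩ₀ z.2.2 z.1.1
  have hΩs : Measurable fun θ : sphere (0 : Euc n) 1 => Ω θ.1 := hΩ.comp measurable_subtype_coe
  rw [← eLpNorm_comp_measurePreserving hΩ.aestronglyMeasurable hmp', hcomp,
    ← eLpNorm_map_measure hΩs.aestronglyMeasurable measurable_fst.aemeasurable,
    Measure.map_fst_prod, Measure.restrict_apply_univ, eLpNorm_smul_measure_of_ne_zero hν0, hν',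
    smul_eq_mul]
  rfl

theorem eLpNorm_sub_left_ball_eq_sphereLpNorm {n : ℕ} (hn : 1 ≤ n) {s : ℝ≥0∞} {Ω : Euc n → ℝ}
    (hΩ : Measurable Ω) (hΩ₀ : HomogZero Ω) (x : Euc n) {r : ℝ} (hr : 0 < r) :
    eLpNorm (fun y => Ω (x - y)) s (volume.restrict (ball x r)) =
      (volume (ball x r) / (volume : Measure (Euc n)).toSphere Set.univ) ^
        (1 / s).toReal * sphereLpNorm n s Ω := by
  have hmp := (Measure.measurePreserving_sub_left (volume : Measure (Euc n)) x).restrict_preimage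
    (s := ball (0 : Euc n) r) measurableSet_ball
  have hpre : (fun y => x - y) ⁻¹' ball (0 : Euc n) r = ball x r := by
    ext y
    simp [mem_ball, dist_eq_norm, norm_sub_rev]
  rw [hpre] at hmp
  have hv : volume (ball x r) = volume (ball (0 : Euc n) r) := Measure.addHaar_ball_center _ x r
  rw [hv, ← eLpNorm_ball_eq_sphereLpNorm hn hΩ hΩ₀ hr,
    ← eLpNorm_comp_measurePreserving hΩ.aestronglyMeasurable hmp]
  rfl

theorem ofReal_conjExp {s : ℝ≥0∞} (hs : 1 < s) : ENNReal.ofReal (conjExp s) = (1 - s⁻¹)⁻¹ := by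
  rcases eq_or_ne s ⊤ with rfl | h
  · simp [conjExp]
  · lift s to NNReal using h
    have hs' : (1 : ℝ) < s := by exact_mod_cast hs
    have h0 : (s : ℝ) ≠ 0 := by positivity
    have h1 : (s : ℝ) - 1 ≠ 0 := by linarith
    have e : (s : ℝ≥0∞) = ENNReal.ofReal s := by simp
    simp only [conjExp, ENNReal.coe_ne_top, if_false, ENNReal.coe_toReal]
    rw [e, ← ENNReal.ofReal_inv_of_pos (by positivity), ← ENNReal.ofReal_one,
      ← ENNReal.ofReal_sub _ (by positivity), ← ENNReal.ofReal_inv_of_pos]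
    · congr 1
      field_simp
    · have := inv_lt_one_of_one_lt₀ hs'
      linarith

theorem one_le_conjExp {s : ℝ≥0∞} (hs : 1 < s) : 1 ≤ conjExp s := by
  rw [← ENNReal.one_le_ofReal, ofReal_conjExp hs]
  exact ENNReal.one_le_inv.2 tsub_le_self

theorem one_div_toReal_add_one_div_conjExp {s : ℝ≥0∞} (hs : 1 < s) :
    (1 / s).toReal + 1 / conjExp s = 1 := by
  rcases eq_or_ne s ⊤ with rfl | h
  · simp [conjExp]
  · lift s to NNReal using h
    have hs' : (1 : ℝ) < s := by exact_mod_cast hs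
    have h0 : (s : ℝ) ≠ 0 := by positivity
    have h1 : (s : ℝ) - 1 ≠ 0 := by linarith
    simp only [conjExp, ENNReal.coe_ne_top, if_false, ENNReal.coe_toReal, one_div,
      ENNReal.toReal_inv]
    field_simp
    ring

theorem eLpNorm_ball_le_morreyNorm {n : ℕ} {p : ℝ} (hp : 0 < p) (κ : ℝ) (f : Euc n → ℝ)
    (x : Euc n) {r : ℝ} (hr : 0 < r) :
    eLpNorm f (ENNReal.ofReal p) (volume.restrict (ball x r)) ≤
      volume (ball x r) ^ (κ / p) * morreyNorm p κ f := by
  have hV0 : volume (ball x r) ≠ 0 := (measure_ball_pos volume x hr).ne'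
  have hVt : volume (ball x r) ≠ ⊤ := measure_ball_lt_top.ne
  have hle : (volume (ball x r) ^ (-κ) *
      ∫⁻ y in ball x r, ENNReal.ofReal |f y| ^ p) ^ (1 / p) ≤ morreyNorm p κ f :=
    le_iSup₂_of_le (f := fun (z : Euc n) (ρ : Set.Ioi (0 : ℝ)) =>
      (volume (ball z (ρ : ℝ)) ^ (-κ) *
        ∫⁻ y in ball z (ρ : ℝ), ENNReal.ofReal |f y| ^ p) ^ (1 / p)) x ⟨r, hr⟩ le_rfl
  refine le_trans (le_of_eq ?_) (mul_le_mul_right hle _)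
  rw [eLpNorm_eq_lintegral_rpow_enorm_toReal (by simpa using hp) ENNReal.ofReal_ne_top,
    ENNReal.toReal_ofReal hp.le, ENNReal.mul_rpow_of_nonneg _ _ (by positivity),
    ← ENNReal.rpow_mul, ← mul_assoc, ← ENNReal.rpow_add _ _ hV0 hVt]
  have : κ / p + -κ * (1 / p) = 0 := by ring
  simp only [this, ENNReal.rpow_zero, one_mul, ← Real.norm_eq_abs, ofReal_norm]

/-- Hölder's inequality for the kernel `Ω(x - ·)` against a function in a Morrey space. -/
theorem lintegral_ball_kernel_mul_le {n : ℕ} (hn : 1 ≤ n) {s : ℝ≥0∞} (hs : 1 < s)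
    {Ω : Euc n → ℝ} (hΩ : Measurable Ω) (hΩ₀ : HomogZero Ω) {p : ℝ} (hp : conjExp s ≤ p) (κ : ℝ)
    {f : Euc n → ℝ} (hf : Measurable f) (x : Euc n) {r : ℝ} (hr : 0 < r) :
    ∫⁻ y in ball x r, ENNReal.ofReal |Ω (x - y) * f y| ≤
      volume (ball x r) ^ (1 - 1 / p + κ / p) *
        (((volume : Measure (Euc n)).toSphere Set.univ)⁻¹ ^ (1 / s).toReal *
          sphereLpNorm n s Ω * morreyNorm p κ f) := by
  have hp0 : 0 < p := by linarith [one_le_conjExp hs]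
  have hV0 : volume (ball x r) ≠ 0 := (measure_ball_pos volume x hr).ne'
  have hVt : volume (ball x r) ≠ ⊤ := measure_ball_lt_top.ne
  have : ENNReal.HolderConjugate s (ENNReal.ofReal (conjExp s)) := by
    rw [ofReal_conjExp hs]
    exact ENNReal.HolderConjugate.inv_one_sub_inv' hs.le
  have hΩx : Measurable fun y => Ω (x - y) := hΩ.comp (measurable_const.sub measurable_id)
  calc ∫⁻ y in ball x r, ENNReal.ofReal |Ω (x - y) * f y|
      = eLpNorm ((fun y => Ω (x - y)) • f) 1 (volume.restrict (ball x r)) := by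
        simp only [eLpNorm_one_eq_lintegral_enorm, ← Real.norm_eq_abs, ofReal_norm]
        rfl
    _ ≤ eLpNorm (fun y => Ω (x - y)) s (volume.restrict (ball x r)) *
          eLpNorm f (ENNReal.ofReal (conjExp s)) (volume.restrict (ball x r)) :=
        eLpNorm_smul_le_mul_eLpNorm hf.aestronglyMeasurable hΩx.aestronglyMeasurable
    _ ≤ ((volume (ball x r) / (volume : Measure (Euc n)).toSphere Set.univ) ^ (1 / s).toReal *
          sphereLpNorm n s Ω) * ((volume (ball x r) ^ (κ / p) * morreyNorm p κ f) *
            volume (ball x r) ^ (1 / conjExp s - 1 / p)) := by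
        rw [eLpNorm_sub_left_ball_eq_sphereLpNorm hn hΩ hΩ₀ x hr]
        gcongr
        refine (eLpNorm_le_eLpNorm_mul_rpow_measure_univ (ENNReal.ofReal_le_ofReal hp)
          hf.aestronglyMeasurable).trans ?_
        rw [Measure.restrict_apply_univ, ENNReal.toReal_ofReal hp0.le,
          ENNReal.toReal_ofReal (by linarith [one_le_conjExp hs])]
        gcongr
        exact eLpNorm_ball_le_morreyNorm hp0 κ f x hr
    _ = _ := by
        have he : 1 - 1 / p + κ / p = (1 / s).toReal + (κ / p + (1 / conjExp s - 1 / p)) := by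
          linarith [one_div_toReal_add_one_div_conjExp hs]
        rw [he, ENNReal.rpow_add _ _ hV0 hVt, ENNReal.rpow_add _ _ hV0 hVt, div_eq_mul_inv,
          ENNReal.mul_rpow_of_nonneg _ _ ENNReal.toReal_nonneg]
        ring

/-- Critical-case boundedness of the multilinear fractional maximal operator with
homogeneous kernels from Morrey spaces into `L^∞` when `κ = 1 - αp/n`. -/
theorem stmt14
    (n m : ℕ) (hn : 2 ≤ n) (hm : 1 ≤ m) (α : ℝ) (hα : 0 < α) (hαmn : α < m * n)
    (s : ℝ≥0∞) (hs : 1 < s) (Ω : Fin m → Euc n → ℝ) (hΩ : ∀ i, MemSphereLp n s (Ω i))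
    (p : Fin m → ℝ) (P q κ : ℝ)
    (hpi : ∀ i, conjExp s ≤ p i)
    (hP : 1 / P = ∑ i, 1 / p i) (hPhigh : P < n / α)
    (hq : 1 / q = 1 / P - α / n)
    (hκ : κ = P / q) (hκ' : κ = 1 - α * P / n) :
    ∃ C : ℝ, 0 < C ∧ ∀ f : Fin m → Euc n → ℝ,
      (∀ i, Measurable (f i)) → (∀ i, morreyNorm (p i) κ (f i) < ⊤) →
      essSup (fun x => multiMF m α Ω f x) volume ≤
        ENNReal.ofReal C * ∏ i, morreyNorm (p i) κ (f i) := by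
  have hn0 : (n : ℝ) ≠ 0 := by positivity
  have hm0 : (m : ℝ) ≠ 0 := by positivity
  have hp0 : ∀ i, 0 < p i := fun i => by linarith [one_le_conjExp hs, hpi i]
  have hP0 : P ≠ 0 := by
    rintro rfl
    have : Nonempty (Fin m) := ⟨⟨0, hm⟩⟩
    have : 0 < ∑ i, 1 / p i :=
      Finset.sum_pos (fun i _ => one_div_pos.2 (hp0 i)) Finset.univ_nonempty
    rw [← hP] at this
    simp at this
  have : Nonempty (Fin n) := ⟨⟨0, by omega⟩⟩
  let K : Fin m → ℝ≥0∞ := fun i =>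
    ((volume : Measure (Euc n)).toSphere Set.univ)⁻¹ ^ (1 / s).toReal * sphereLpNorm n s (Ω i)
  have hKt : ∏ i, K i ≠ ⊤ := by
    refine ENNReal.prod_ne_top fun i _ => ENNReal.mul_ne_top ?_ (hΩ i).2.2.ne
    refine ENNReal.rpow_ne_top_of_nonneg ENNReal.toReal_nonneg (ENNReal.inv_ne_top.2 ?_)
    exact Measure.measure_univ_ne_zero.2 (Measure.toSphere_ne_zero volume)
  have hexp : ∑ i, (α / (m * n : ℝ) - 1 + (1 - 1 / p i + κ / p i)) = 0 := by
    have h1 : ∀ i, α / (m * n : ℝ) - 1 + (1 - 1 / p i + κ / p i) =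
        α / (m * n : ℝ) + (κ - 1) * (1 / p i) := fun i => by ring
    rw [Finset.sum_congr rfl fun i _ => h1 i, Finset.sum_add_distrib, ← Finset.mul_sum, ← hP, hκ',
      Finset.sum_const, Finset.card_univ, Fintype.card_fin, nsmul_eq_mul]
    field_simp
    ring
  refine ⟨(∏ i, K i).toReal + 1, by positivity, fun f hf _ => ?_⟩
  have hKC : ∏ i, K i ≤ ENNReal.ofReal ((∏ i, K i).toReal + 1) :=
    (ENNReal.ofReal_toReal hKt).symm.le.trans (ENNReal.ofReal_le_ofReal (by linarith))
  refine essSup_le_of_ae_le _ (Filter.Eventually.of_forall fun x => iSup_le fun r => ?_)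
  have hr : 0 < (r : ℝ) := r.2
  have hV0 : volume (ball x (r : ℝ)) ≠ 0 := (measure_ball_pos volume x hr).ne'
  have hVt : volume (ball x (r : ℝ)) ≠ ⊤ := measure_ball_lt_top.ne
  calc _ ≤ ∏ i, volume (ball x (r : ℝ)) ^ (α / (m * n : ℝ) - 1 + (1 - 1 / p i + κ / p i)) *
          (K i * morreyNorm (p i) κ (f i)) := by
        refine Finset.prod_le_prod' fun i _ => ?_
        rw [ENNReal.rpow_add _ _ hV0 hVt, mul_assoc]
        gcongr
        exact lintegral_ball_kernel_mul_le (by omega) hs (hΩ i).1 (hΩ i).2.1 (hpi i) κ (hf i) x hr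
    _ = (∏ i, K i) * ∏ i, morreyNorm (p i) κ (f i) := by
        rw [Finset.prod_mul_distrib, Finset.prod_mul_distrib,
          prod_rpow_eq_rpow_sum hV0 hVt, hexp, ENNReal.rpow_zero, one_mul]
    _ ≤ _ := mul_le_mul_left hKC _

end
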